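/- arXiv:1509.01949 — 4 statements merged into one kernel-verified Lean document; each statement's English description precedes it below -/
import Mathlib

section
/- Let A be a symmetric positive-definite n×n real matrix, and suppose B : (0,∞)^m → (0,∞) is twice differentiable, increasing in each variable, and there exists λ ≥ 0 such that D²B(x) ≤ λ·diag(∂₁B(x)/x₁, …, ∂_mB(x)/x_m) for all x ∈ (0,∞)^m. Let u₁,…,u_m : (0,∞) × ℝⁿ → (0,∞) be smooth positive solutions of the heat equation ∂_t u_j = div(A⁻¹∇u_j) satisfying the Li–Yau estimate D²(log u_j) ≥ −A/(2t), such that the function x ↦ B(u₁(t,x),…,u_m(t,x)) is integrable for each t, with differentiation under the integral sign and the divergence theorem applicable. Then the function t ↦ t^{λn/2} ∫_{ℝⁿ} B(u₁(t,x),…,u_m(t,x)) dx is nondecreasing on (0,∞). -/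
noncomputable section
open Real MeasureTheory Matrix Set

/-- Partial derivative of `f` in the `i`-th coordinate direction. -/
def pd {ι : Type*} [Fintype ι] [DecidableEq ι] (f : (ι → ℝ) → ℝ) (i : ι) (x : ι → ℝ) : ℝ :=
  fderiv ℝ f x (Pi.single i 1)

/-- Spatial gradient. -/
def grad' {ι : Type*} [Fintype ι] [DecidableEq ι] (f : (ι → ℝ) → ℝ) (x : ι → ℝ) : ι → ℝ :=
  fun i => pd f i x

/-- Spatial divergence of a vector field. -/
def div' {ι : Type*} [Fintype ι] [DecidableEq ι] (V : (ι → ℝ) → ι → ℝ) (x : ι → ℝ) : ℝ :=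
  ∑ i, pd (fun y => V y i) i x

/-- Hessian matrix. -/
def hess' {ι : Type*} [Fintype ι] [DecidableEq ι] (f : (ι → ℝ) → ℝ) (x : ι → ℝ) :
    Matrix ι ι ℝ :=
  Matrix.of fun i j => pd (fun y => pd f j y) i x

section Calculus

variable {ι : Type*} [Fintype ι] [DecidableEq ι]

theorem fderiv_apply_eq_sum_pd (f : (ι → ℝ) → ℝ) (x v : ι → ℝ) :
    fderiv ℝ f x v = ∑ i, v i * pd f i x := by
  conv_lhs => rw [← Finset.univ_sum_single v, map_sum]
  refine Finset.sum_congr rfl fun i _ => ?_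
  have h : (Pi.single i (v i) : ι → ℝ) = v i • Pi.single i 1 := by
    ext k
    by_cases hk : k = i
    · subst hk; simp
    · simp [hk]
  rw [h, map_smul, smul_eq_mul, pd]

theorem differentiableAt_pd {f : (ι → ℝ) → ℝ} {x : ι → ℝ} (hf : ContDiffAt ℝ 2 f x) (i : ι) :
    DifferentiableAt ℝ (pd f i) x :=
  ((hf.fderiv_right (m := 1) (by norm_num)).differentiableAt one_ne_zero).clm_apply
    (differentiableAt_const _)

theorem pd_eq_of_hasFDerivAt {f : (ι → ℝ) → ℝ} {f' : (ι → ℝ) →L[ℝ] ℝ} {x : ι → ℝ}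
    (h : HasFDerivAt f f' x) (i : ι) : pd f i x = f' (Pi.single i 1) := by
  rw [pd, h.fderiv]

theorem pd_mul {f g : (ι → ℝ) → ℝ} {x : ι → ℝ} (hf : DifferentiableAt ℝ f x)
    (hg : DifferentiableAt ℝ g x) (i : ι) :
    pd (fun y => f y * g y) i x = pd f i x * g x + f x * pd g i x := by
  rw [pd_eq_of_hasFDerivAt (hf.hasFDerivAt.fun_mul hg.hasFDerivAt)]
  simp [pd]
  ring

theorem pd_const_mul {f : (ι → ℝ) → ℝ} {x : ι → ℝ} (hf : DifferentiableAt ℝ f x) (c : ℝ) (i : ι) :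
    pd (fun y => c * f y) i x = c * pd f i x := by
  rw [pd_eq_of_hasFDerivAt (hf.hasFDerivAt.const_mul c)]
  simp [pd]

theorem pd_sum {κ : Type*} (s : Finset κ) {f : κ → (ι → ℝ) → ℝ} {x : ι → ℝ}
    (hf : ∀ k ∈ s, DifferentiableAt ℝ (f k) x) (i : ι) :
    pd (fun y => ∑ k ∈ s, f k y) i x = ∑ k ∈ s, pd (f k) i x := by
  rw [pd_eq_of_hasFDerivAt (HasFDerivAt.fun_sum fun k hk => (hf k hk).hasFDerivAt)]
  simp [pd]

/-- Chain rule for partial derivatives. -/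
theorem pd_comp {κ : Type*} [Fintype κ] [DecidableEq κ] {F : (κ → ℝ) → ℝ}
    {v : κ → (ι → ℝ) → ℝ} {x : ι → ℝ} (hF : DifferentiableAt ℝ F (fun j => v j x))
    (hv : ∀ j, DifferentiableAt ℝ (v j) x) (i : ι) :
    pd (fun y => F fun j => v j y) i x = ∑ j, pd F j (fun j => v j x) * pd (v j) i x := by
  have h := hF.hasFDerivAt.comp x (hasFDerivAt_pi.2 fun j => (hv j).hasFDerivAt)
  have h' : HasFDerivAt (fun y => F fun j => v j y) _ x := h
  rw [pd_eq_of_hasFDerivAt h', ContinuousLinearMap.comp_apply, fderiv_apply_eq_sum_pd]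
  simp [pd, mul_comm]

/-- The flux divergence `div (M ∇f)` as a contraction of `M` with the Hessian. -/
theorem div_mulVec_grad {f : (ι → ℝ) → ℝ} {x : ι → ℝ} (hf : ContDiffAt ℝ 2 f x)
    (M : Matrix ι ι ℝ) :
    div' (fun y => M.mulVec (grad' f y)) x = ∑ i, ∑ k, M i k * hess' f x i k := by
  simp only [div', Matrix.mulVec, dotProduct, grad', hess', Matrix.of_apply]
  refine Finset.sum_congr rfl fun i _ => ?_
  rw [pd_sum _ fun k _ => (differentiableAt_pd hf k).const_mul _]
  exact Finset.sum_congr rfl fun k _ => pd_const_mul (differentiableAt_pd hf k) _ _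

theorem hess_const_mul {f : (ι → ℝ) → ℝ} (hf : ContDiff ℝ 2 f) (c : ℝ) (x : ι → ℝ) (i k : ι) :
    hess' (fun y => c * f y) x i k = c * hess' f x i k := by
  simp only [hess', Matrix.of_apply]
  have h : (fun y => pd (fun y => c * f y) k y) = fun y => c * pd f k y :=
    funext fun y => pd_const_mul (hf.contDiffAt.differentiableAt two_ne_zero) c k
  rw [h]
  exact pd_const_mul (differentiableAt_pd hf.contDiffAt k) c i

/-- Chain rule for second partial derivatives. -/
theorem hess_comp {κ : Type*} [Fintype κ] [DecidableEq κ] {F : (κ → ℝ) → ℝ}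
    {v : κ → (ι → ℝ) → ℝ} (hF : ∀ y, ContDiffAt ℝ 2 F (fun j => v j y))
    (hv : ∀ j, ContDiff ℝ 2 (v j)) (x : ι → ℝ) (i k : ι) :
    hess' (fun y => F fun j => v j y) x i k =
      ∑ j, pd F j (fun j => v j x) * hess' (v j) x i k +
      ∑ j, ∑ l, hess' F (fun j => v j x) l j * (pd (v l) i x * pd (v j) k x) := by
  have hd : ∀ j y, DifferentiableAt ℝ (v j) y := fun j y =>
    (hv j).contDiffAt.differentiableAt two_ne_zero
  have hcomp : ∀ j, DifferentiableAt ℝ (fun y => pd F j fun j => v j y) x := fun j =>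
    (differentiableAt_pd (hF x) j).comp (f := fun y j => v j y) x
      (differentiableAt_pi.2 fun j => hd j x)
  simp only [hess', Matrix.of_apply]
  have h : (fun y => pd (fun y => F fun j => v j y) k y) =
      fun y => ∑ j, pd F j (fun j => v j y) * pd (v j) k y :=
    funext fun y => pd_comp ((hF y).differentiableAt two_ne_zero) (fun j => hd j y) k
  rw [h, pd_sum _ fun j _ => (hcomp j).fun_mul (differentiableAt_pd (hv j).contDiffAt k),
    ← Finset.sum_add_distrib]
  refine Finset.sum_congr rfl fun j _ => ?_
  rw [pd_mul (hcomp j) (differentiableAt_pd (hv j).contDiffAt k),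
    pd_comp (differentiableAt_pd (hF x) j) (fun j => hd j x), Finset.sum_mul, add_comm]
  congr 1
  exact Finset.sum_congr rfl fun l _ => by ring

theorem hess_log {v : (ι → ℝ) → ℝ} (hv : ContDiff ℝ 2 v) (hpos : ∀ y, 0 < v y) (x : ι → ℝ)
    (i k : ι) :
    hess' (fun y => Real.log (v y)) x i k =
      hess' v x i k / v x - pd v i x * pd v k x / v x ^ 2 := by
  have hd : ∀ y, DifferentiableAt ℝ v y := fun y => hv.contDiffAt.differentiableAt two_ne_zero
  simp only [hess', Matrix.of_apply]
  have h : (fun y => pd (fun y => Real.log (v y)) k y) = fun y => (v y)⁻¹ * pd v k y := by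
    funext y
    rw [pd_eq_of_hasFDerivAt ((hd y).hasFDerivAt.log (hpos y).ne')]
    simp [pd]
  have hinv : HasFDerivAt (fun y => (v y)⁻¹) _ x :=
    (hasDerivAt_inv (hpos x).ne').comp_hasFDerivAt x (hd x).hasFDerivAt
  rw [h, pd_mul hinv.differentiableAt (differentiableAt_pd hv.contDiffAt k),
    pd_eq_of_hasFDerivAt hinv]
  have := (hpos x).ne'
  simp only [_root_.smul_apply, smul_eq_mul]
  rw [← pd]
  field_simp
  ring

end Calculus

/-- The entrywise pairing of two positive semidefinite real matrices is nonnegative. -/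
theorem Matrix.PosSemidef.sum_mul_nonneg {ι : Type*} [Fintype ι] [DecidableEq ι]
    {P Q : Matrix ι ι ℝ} (hP : P.PosSemidef) (hQ : Q.PosSemidef) :
    0 ≤ ∑ i, ∑ k, P i k * Q i k := by
  have h := (hP.hadamard hQ).dotProduct_mulVec_nonneg 1
  simpa [Matrix.mulVec, dotProduct] using h

/-- A positive function on the half-line with `s g'' ≤ lam g'` satisfies `s g' ≤ (1 + lam) g`,
stated here at `s = 1`. -/
theorem deriv_le_of_mul_deriv_deriv_le {g g' g'' : ℝ → ℝ} {lam : ℝ} (hlam : 0 ≤ lam)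
    (hg : ∀ s > 0, HasDerivAt g (g' s) s) (hg' : ∀ s > 0, HasDerivAt g' (g'' s) s)
    (hpos : ∀ s > 0, 0 < g s) (h : ∀ s > 0, s * g'' s ≤ lam * g' s) :
    g' 1 ≤ (1 + lam) * g 1 := by
  by_contra! hc
  set c := g' 1 - (1 + lam) * g 1 with hc_def
  have hc0 : 0 < c := by linarith
  have hd : ∀ s > 0, HasDerivAt (fun s => s * g' s - (1 + lam) * g s)
      (1 * g' s + s * g'' s - (1 + lam) * g' s) s := fun s hs =>
    ((hasDerivAt_id' s).fun_mul (hg' s hs)).fun_sub ((hg s hs).const_mul (1 + lam))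
  have hanti : AntitoneOn (fun s => s * g' s - (1 + lam) * g s) (Ioi 0) := by
    refine antitoneOn_of_deriv_nonpos (convex_Ioi 0)
      (fun s hs => (hd s hs).continuousAt.continuousWithinAt) ?_ ?_
    · rw [interior_Ioi]
      exact fun s hs => (hd s hs).differentiableAt.differentiableWithinAt
    · rw [interior_Ioi]
      intro s hs
      rw [(hd s hs).deriv]
      linarith [h s hs]
  have hlow : ∀ s > 0, s ≤ 1 → c ≤ s * g' s := by
    intro s hs hs1
    have h1 := hanti (mem_Ioi.2 hs) (mem_Ioi.2 one_pos) hs1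
    have h2 : 0 ≤ (1 + lam) * g s := mul_nonneg (by linarith) (hpos s hs).le
    simp only [one_mul] at h1
    linarith
  have hk : ∀ s > 0, HasDerivAt (fun s => g s - c * Real.log s) (g' s - c * s⁻¹) s :=
    fun s hs => (hg s hs).fun_sub ((Real.hasDerivAt_log hs.ne').const_mul c)
  have hmono : MonotoneOn (fun s => g s - c * Real.log s) (Ioc 0 1) := by
    refine monotoneOn_of_deriv_nonneg (convex_Ioc 0 1)
      (fun s hs => (hk s hs.1).continuousAt.continuousWithinAt) ?_ ?_
    · rw [interior_Ioc]
      exact fun s hs => (hk s hs.1).differentiableAt.differentiableWithinAt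
    · rw [interior_Ioc]
      intro s hs
      rw [(hk s hs.1).deriv, sub_nonneg, ← div_eq_mul_inv, div_le_iff₀ hs.1, mul_comm]
      exact hlow s hs.1 hs.2.le
  have hle : Real.exp (-(g 1 / c)) ≤ 1 :=
    Real.exp_le_one_iff.2 (neg_nonpos.2 (div_pos (hpos 1 one_pos) hc0).le)
  have h1 := hmono ⟨Real.exp_pos _, hle⟩ ⟨one_pos, le_rfl⟩ hle
  have h2 := hpos _ (Real.exp_pos (-(g 1 / c)))
  have h3 : c * (g 1 / c) = g 1 := mul_div_cancel₀ _ hc0.ne'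
  simp only [Real.log_exp, Real.log_one] at h1
  linarith

theorem isOpen_forall_pos {κ : Type*} [Finite κ] : IsOpen {x : κ → ℝ | ∀ i, 0 < x i} := by
  simp only [ofPred_forall]
  exact isOpen_iInter_of_finite fun i => isOpen_lt continuous_const (continuous_apply i)

section Concavity

variable {κ : Type*} [Fintype κ] [DecidableEq κ] {B : (κ → ℝ) → ℝ} {lam : ℝ}

theorem sum_hess_mul_le {y : κ → ℝ}
    (h : (lam • Matrix.diagonal (fun j => pd B j y / y j) - hess' B y).PosSemidef)
    {Q : Matrix κ κ ℝ} (hQ : Q.PosSemidef) :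
    ∑ j, ∑ l, hess' B y l j * Q l j ≤ lam * ∑ j, pd B j y / y j * Q j j := by
  have h0 := h.sum_mul_nonneg hQ
  simp only [Matrix.sub_apply, Matrix.smul_apply, smul_eq_mul, sub_mul, Finset.sum_sub_distrib,
    Matrix.diagonal_apply, mul_ite, ite_mul, mul_zero, zero_mul, Finset.sum_ite_eq,
    Finset.mem_univ, if_true] at h0
  rw [Finset.sum_comm, Finset.mul_sum]
  simp only [← mul_assoc]
  linarith

/-- The Hessian bound forces `x · ∇B ≤ (1 + lam) B`. -/
theorem sum_mul_pd_le (hB_smooth : ContDiffOn ℝ 2 B {x | ∀ i, 0 < x i})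
    (hB_pos : ∀ x, (∀ i, 0 < x i) → 0 < B x) (hlam : 0 ≤ lam)
    (hB_hess : ∀ x, (∀ i, (0 : ℝ) < x i) →
      (lam • Matrix.diagonal (fun j => pd B j x / x j) - hess' B x).PosSemidef)
    {x : κ → ℝ} (hx : ∀ i, 0 < x i) :
    ∑ j, x j * pd B j x ≤ (1 + lam) * B x := by
  have hpos : ∀ s : ℝ, s > 0 → ∀ i, 0 < (s • x) i := fun s hs i => mul_pos hs (hx i)
  have hB : ∀ s : ℝ, s > 0 → ContDiffAt ℝ 2 B (s • x) := fun s hs =>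
    hB_smooth.contDiffAt (isOpen_forall_pos.mem_nhds (hpos s hs))
  have hray : ∀ s : ℝ, HasDerivAt (fun s : ℝ => s • x) x s := fun s => by
    simpa using (hasDerivAt_id' s).smul_const x
  have hcomp : ∀ {f : (κ → ℝ) → ℝ} {s : ℝ}, DifferentiableAt ℝ f (s • x) →
      HasDerivAt (fun s : ℝ => f (s • x)) (∑ i, x i * pd f i (s • x)) s := fun {f s} hf => by
    rw [← fderiv_apply_eq_sum_pd]
    exact hf.hasFDerivAt.comp_hasDerivAt s (hray s)
  have key := deriv_le_of_mul_deriv_deriv_le (g := fun s => B (s • x))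
    (g' := fun s => ∑ j, x j * pd B j (s • x))
    (g'' := fun s => ∑ j, x j * ∑ i, x i * pd (pd B j) i (s • x)) hlam
    (fun s hs => hcomp ((hB s hs).differentiableAt two_ne_zero))
    (fun s hs => HasDerivAt.fun_sum fun j _ =>
      (hcomp (differentiableAt_pd (hB s hs) j)).const_mul (x j))
    (fun s hs => hB_pos _ (hpos s hs)) ?_
  · simpa using key
  intro s hs
  have h := sum_hess_mul_le (hB_hess _ (hpos s hs)) (Matrix.posSemidef_vecMulVec_self_star x)
  have hl : ∑ j, ∑ l, hess' B (s • x) l j * Matrix.vecMulVec x (star x) l j =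
      ∑ j, x j * ∑ i, x i * pd (pd B j) i (s • x) := by
    refine Finset.sum_congr rfl fun j _ => ?_
    rw [Finset.mul_sum]
    refine Finset.sum_congr rfl fun i _ => ?_
    simp only [hess', Matrix.of_apply, Matrix.vecMulVec_apply, star_trivial]
    ring
  have hr : s * ∑ j, pd B j (s • x) / (s • x) j * Matrix.vecMulVec x (star x) j j =
      ∑ j, x j * pd B j (s • x) := by
    rw [Finset.mul_sum]
    refine Finset.sum_congr rfl fun j _ => ?_
    simp only [Matrix.vecMulVec_apply, star_trivial, Pi.smul_apply, smul_eq_mul]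
    have := (hx j).ne'
    field_simp
  rw [hl] at h
  calc s * ∑ j, x j * ∑ i, x i * pd (pd B j) i (s • x) ≤ s * (lam * _) :=
        mul_le_mul_of_nonneg_left h hs.le
    _ = lam * ∑ j, x j * pd B j (s • x) := by rw [← hr]; ring

end Concavity

section LiYau

variable {ι : Type*} [Fintype ι] [DecidableEq ι] {A : Matrix ι ι ℝ}

/-- Traced form of the Li–Yau estimate. -/
theorem sum_inv_mul_pd_mul_pd_le (hA : A.PosDef) {v : (ι → ℝ) → ℝ} (hv : ContDiff ℝ 2 v)
    (hpos : ∀ y, 0 < v y) {x : ι → ℝ} {a : ℝ}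
    (h : (hess' (fun y => Real.log (v y)) x + a • A).PosSemidef) :
    ∑ i, ∑ k, A⁻¹ i k * (pd v i x * pd v k x) ≤
      v x * (∑ i, ∑ k, A⁻¹ i k * hess' v x i k + a * Fintype.card ι * v x) := by
  have h0 := hA.inv.posSemidef.sum_mul_nonneg h
  have htr : ∑ i, ∑ k, A⁻¹ i k * A i k = Fintype.card ι := by
    have h1 : A⁻¹ * A = 1 :=
      Matrix.nonsing_inv_mul _ ((Matrix.isUnit_iff_isUnit_det _).1 hA.isUnit)
    have h2 : (A⁻¹ * A).trace = Fintype.card ι := by rw [h1, Matrix.trace_one]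
    rw [← h2, Matrix.trace]
    simp only [Matrix.diag_apply, Matrix.mul_apply]
    refine Finset.sum_congr rfl fun i _ => Finset.sum_congr rfl fun k _ => ?_
    rw [← hA.isHermitian.apply i k, star_trivial]
  have hx := (hpos x).ne'
  have hsum : v x ^ 2 * ∑ i, ∑ k, A⁻¹ i k * (hess' (fun y => Real.log (v y)) x + a • A) i k =
      v x * ∑ i, ∑ k, A⁻¹ i k * hess' v x i k - ∑ i, ∑ k, A⁻¹ i k * (pd v i x * pd v k x)
        + v x ^ 2 * a * ∑ i, ∑ k, A⁻¹ i k * A i k := by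
    simp only [Finset.mul_sum, ← Finset.sum_sub_distrib, ← Finset.sum_add_distrib]
    refine Finset.sum_congr rfl fun i _ => Finset.sum_congr rfl fun k _ => ?_
    rw [Matrix.add_apply, Matrix.smul_apply, hess_log hv hpos, smul_eq_mul]
    field_simp
  have h1 := mul_nonneg (sq_nonneg (v x)) h0
  rw [hsum, htr] at h1
  linarith

/-- The composite `B ∘ v` is a subsolution up to the factor `1 + lam` and a zeroth-order term. -/
theorem div_flux_comp_le {κ : Type*} [Fintype κ] [DecidableEq κ] {B : (κ → ℝ) → ℝ} {lam : ℝ}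
    (hA : A.PosDef) (hB_smooth : ContDiffOn ℝ 2 B {x | ∀ i, 0 < x i})
    (hB_pos : ∀ x, (∀ i, 0 < x i) → 0 < B x)
    (hB_mono : ∀ x, (∀ i, (0 : ℝ) < x i) → ∀ j, 0 ≤ pd B j x) (hlam : 0 ≤ lam)
    (hB_hess : ∀ x, (∀ i, (0 : ℝ) < x i) →
      (lam • Matrix.diagonal (fun j => pd B j x / x j) - hess' B x).PosSemidef)
    {v : κ → (ι → ℝ) → ℝ} (hv : ∀ j, ContDiff ℝ 2 (v j)) (hpos : ∀ j y, 0 < v j y)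
    {x : ι → ℝ} {a : ℝ} (ha : 0 ≤ a)
    (h : ∀ j, (hess' (fun y => Real.log (v j y)) x + a • A).PosSemidef) :
    ∑ i, ∑ k, A⁻¹ i k * hess' (fun y => B fun j => v j y) x i k ≤
      (1 + lam) * (∑ j, pd B j (fun j => v j x) * ∑ i, ∑ k, A⁻¹ i k * hess' (v j) x i k +
        lam * (a * Fintype.card ι) * B fun j => v j x) := by
  have hBv : ∀ y, ContDiffAt ℝ 2 B (fun j => v j y) := fun y =>
    hB_smooth.contDiffAt (isOpen_forall_pos.mem_nhds fun j => hpos j y)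
  set w : κ → ℝ := fun j => v j x with hw
  have hwpos : ∀ j, 0 < w j := fun j => hpos j x
  let V : Matrix κ ι ℝ := Matrix.of fun j i => pd (v j) i x
  let G : Matrix κ κ ℝ := V * A⁻¹ * Vᴴ
  have hG : G.PosSemidef := hA.inv.posSemidef.mul_mul_conjTranspose_same V
  have hG_apply : ∀ l j, G l j = ∑ i, ∑ k, A⁻¹ i k * (pd (v l) i x * pd (v j) k x) := by
    intro l j
    simp only [G, V, Matrix.mul_apply, Matrix.conjTranspose_apply, Matrix.of_apply, star_trivial,
      Finset.sum_mul]
    rw [Finset.sum_comm]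
    exact Finset.sum_congr rfl fun i _ => Finset.sum_congr rfl fun k _ => by ring
  have hsplit : ∑ i, ∑ k, A⁻¹ i k * hess' (fun y => B fun j => v j y) x i k =
      ∑ j, pd B j w * ∑ i, ∑ k, A⁻¹ i k * hess' (v j) x i k +
        ∑ j, ∑ l, hess' B w l j * G l j := by
    simp only [hess_comp hBv hv, hG_apply, mul_add, Finset.mul_sum, Finset.sum_add_distrib]
    congr 1
    · simp only [Finset.sum_comm (s := (Finset.univ : Finset κ)) (t := (Finset.univ : Finset ι))]
      exact Finset.sum_congr rfl fun i _ => Finset.sum_congr rfl fun k _ =>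
        Finset.sum_congr rfl fun j _ => by ring
    · simp only [Finset.sum_comm (s := (Finset.univ : Finset κ)) (t := (Finset.univ : Finset ι))]
      exact Finset.sum_congr rfl fun i _ => Finset.sum_congr rfl fun k _ =>
        Finset.sum_congr rfl fun j _ => Finset.sum_congr rfl fun l _ => by ring
  have hquad := sum_hess_mul_le (hB_hess w hwpos) hG
  have hdiag : ∑ j, pd B j w / w j * G j j ≤
      ∑ j, pd B j w * ∑ i, ∑ k, A⁻¹ i k * hess' (v j) x i k +
        a * Fintype.card ι * ∑ j, w j * pd B j w := by
    rw [Finset.mul_sum, ← Finset.sum_add_distrib]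
    refine Finset.sum_le_sum fun j _ => ?_
    have h1 := sum_inv_mul_pd_mul_pd_le hA (hv j) (hpos j) (h j)
    rw [← hG_apply] at h1
    have hne := (hwpos j).ne'
    calc pd B j w / w j * G j j ≤ pd B j w / w j * _ :=
          mul_le_mul_of_nonneg_left h1 (div_nonneg (hB_mono w hwpos j) (hwpos j).le)
      _ = _ := by
          change pd B j w / w j * (w j * (_ + _ * w j)) = _
          field_simp
  have heuler := mul_le_mul_of_nonneg_left
    (sum_mul_pd_le hB_smooth hB_pos hlam hB_hess hwpos)
    (mul_nonneg ha (Nat.cast_nonneg (α := ℝ) (Fintype.card ι)))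
  have h2 := mul_le_mul_of_nonneg_left (hdiag.trans (add_le_add_right heuler _)) hlam
  rw [hsplit]
  linarith

end LiYau

/-- For `B` with `D²B ≤ λ diag(∂_jB/x_j)` and solutions `u_j` of the heat equation
satisfying the Li–Yau estimate, `t ↦ t^{λn/2} ∫ B(u₁(t,x),…,u_m(t,x)) dx` is
nondecreasing on `(0,∞)`. -/
theorem general_concavity_monotone_quantity
    {n m : ℕ} (A : Matrix (Fin n) (Fin n) ℝ) (hA : A.PosDef)
    (B : (Fin m → ℝ) → ℝ)
    (hB_smooth : ContDiffOn ℝ 2 B {x | ∀ i, 0 < x i})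
    (hB_pos : ∀ x, (∀ i, 0 < x i) → 0 < B x)
    (hB_mono : ∀ x, (∀ i, (0:ℝ) < x i) → ∀ j, 0 ≤ pd B j x)
    (lam : ℝ) (hlam : 0 ≤ lam)
    (hB_hess : ∀ x, (∀ i, (0:ℝ) < x i) →
      (lam • Matrix.diagonal (fun j => pd B j x / x j) - hess' B x).PosSemidef)
    (u : Fin m → ℝ → (Fin n → ℝ) → ℝ)
    (hu_smooth : ∀ j, ContDiffOn ℝ (⊤ : ℕ∞) (Function.uncurry (u j)) (Set.Ioi (0:ℝ) ×ˢ Set.univ))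
    (hu_pos : ∀ j, ∀ t > (0:ℝ), ∀ x, 0 < u j t x)
    (hu_heat : ∀ j, ∀ t > (0:ℝ), ∀ x,
      deriv (fun s => u j s x) t = div' (fun y => A⁻¹.mulVec (grad' (u j t) y)) x)
    (hu_LiYau : ∀ j, ∀ t > (0:ℝ), ∀ x,
      (hess' (fun y => Real.log (u j t y)) x + (1 / (2 * t)) • A).PosSemidef)
    (util : ℝ → (Fin n → ℝ) → ℝ)
    (hutil : util = fun t x => t ^ (lam * n / 2) * B (fun j => u j t x))
    (hB_int : ∀ t > (0:ℝ), Integrable (fun x => B (fun j => u j t x)))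
    (hd_int : ∀ t > (0:ℝ), Integrable (fun x => deriv (fun s => util s x) t))
    (hdiff_under : ∀ t > (0:ℝ),
      HasDerivAt (fun s => ∫ x, util s x) (∫ x, deriv (fun s => util s x) t) t)
    (hflux_int : ∀ t > (0:ℝ),
      Integrable (fun x => div' (fun y => A⁻¹.mulVec (grad' (util t) y)) x))
    (hdivthm : ∀ t > (0:ℝ),
      (∫ x, div' (fun y => A⁻¹.mulVec (grad' (util t) y)) x) = 0) :
    MonotoneOn (fun t => t ^ (lam * n / 2) * ∫ x, B (fun j => u j t x)) (Set.Ioi (0:ℝ)) := by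
  have hv : ∀ j, ∀ t > (0 : ℝ), ContDiff ℝ 2 (u j t) := by
    intro j t ht
    refine contDiff_iff_contDiffAt.2 fun x => ?_
    have h : ContDiffAt ℝ 2 (Function.uncurry (u j)) (t, x) :=
      ((hu_smooth j).contDiffAt ((isOpen_Ioi.prod isOpen_univ).mem_nhds (mk_mem_prod (mem_Ioi.2 ht) (mem_univ x)))).of_le
        (WithTop.coe_le_coe.2 le_top)
    exact h.comp x (contDiffAt_const.prodMk contDiffAt_id)
  have ht_diff : ∀ j, ∀ t > (0 : ℝ), ∀ x, DifferentiableAt ℝ (fun s => u j s x) t := by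
    intro j t ht x
    have h : DifferentiableAt ℝ (Function.uncurry (u j)) (t, x) :=
      ((hu_smooth j).contDiffAt
        ((isOpen_Ioi.prod isOpen_univ).mem_nhds (mk_mem_prod (mem_Ioi.2 ht) (mem_univ x)))).differentiableAt (by simp)
    exact h.comp t (f := fun s => (s, x))
      (differentiableAt_id.prodMk (differentiableAt_const x))
  have hBu : ∀ t > (0 : ℝ), ∀ x, ContDiffAt ℝ 2 B (fun j => u j t x) := fun t ht x =>
    hB_smooth.contDiffAt (isOpen_forall_pos.mem_nhds fun j => hu_pos j t ht x)
  have hpoint : ∀ t > (0 : ℝ), ∀ x,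
      div' (fun y => A⁻¹.mulVec (grad' (util t) y)) x ≤
        (1 + lam) * deriv (fun s => util s x) t := by
    intro t ht x
    have hBv : ContDiff ℝ 2 fun y => B fun j => u j t y := contDiff_iff_contDiffAt.2 fun y =>
      (hBu t ht y).comp y (contDiffAt_pi.2 fun j => (hv j t ht).contDiffAt)
    have hdiv : div' (fun y => A⁻¹.mulVec (grad' (util t) y)) x =
        t ^ (lam * n / 2) *
          ∑ i, ∑ k, A⁻¹ i k * hess' (fun y => B fun j => u j t y) x i k := by
      rw [hutil, div_mulVec_grad (contDiff_const.mul hBv).contDiffAt]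
      simp only [hess_const_mul hBv, Finset.mul_sum]
      exact Finset.sum_congr rfl fun i _ => Finset.sum_congr rfl fun k _ => by ring
    have hder : deriv (fun s => util s x) t =
        t ^ (lam * n / 2) * (∑ j, pd B j (fun j => u j t x) *
            ∑ i, ∑ k, A⁻¹ i k * hess' (u j t) x i k +
          lam * (1 / (2 * t) * Fintype.card (Fin n)) * B fun j => u j t x) := by
      have h1 : HasDerivAt (fun s => B fun j => u j s x) _ t :=
        ((hBu t ht x).differentiableAt two_ne_zero).hasFDerivAt.comp_hasDerivAt t
          (hasDerivAt_pi.2 fun j => (ht_diff j t ht x).hasDerivAt)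
      have h2 := (Real.hasDerivAt_rpow_const (p := lam * n / 2) (Or.inl ht.ne')).fun_mul h1
      simp only [hutil]
      rw [h2.deriv, fderiv_apply_eq_sum_pd, Real.rpow_sub_one ht.ne', Fintype.card_fin]
      simp only [hu_heat _ t ht x, div_mulVec_grad (hv _ t ht).contDiffAt]
      rw [Finset.sum_congr rfl fun j _ => mul_comm _ (pd B j fun j => u j t x)]
      field_simp
      ring
    rw [hdiv, hder, mul_left_comm]
    exact mul_le_mul_of_nonneg_left
      (div_flux_comp_le hA hB_smooth hB_pos hB_mono hlam hB_hess (fun j => hv j t ht)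
        (fun j => hu_pos j t ht) (by positivity) fun j => hu_LiYau j t ht x)
      (Real.rpow_nonneg ht.le _)
  have hnonneg : ∀ t > (0 : ℝ), 0 ≤ ∫ x, deriv (fun s => util s x) t := by
    intro t ht
    have h := integral_mono (hflux_int t ht) ((hd_int t ht).const_mul (1 + lam)) (hpoint t ht)
    rw [hdivthm t ht, integral_const_mul] at h
    exact nonneg_of_mul_nonneg_right h (by linarith)
  have heq : (fun t => t ^ (lam * n / 2) * ∫ x, B (fun j => u j t x)) =
      fun t => ∫ x, util t x := by
    funext t
    rw [hutil, integral_const_mul]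
  rw [heq]
  refine monotoneOn_of_deriv_nonneg (convex_Ioi 0)
    (fun t ht => (hdiff_under t ht).continuousAt.continuousWithinAt) ?_ ?_ <;>
    rw [interior_Ioi]
  · exact fun t ht => (hdiff_under t ht).differentiableAt.differentiableWithinAt
  · intro t ht
    rw [(hdiff_under t ht).deriv]
    exact hnonneg t ht
end
end

section
/- Let p, q ∈ ℝ be such that p ≥ max{1, q} and q ≠ 0, and define B : (0,∞)² → (0,∞) by B(x₁,x₂) = (x₁^q + x₂^q)^{p/q}. Then B satisfies D²B(x) ≤ (p−1)·diag(∂₁B(x)/x₁, ∂₂B(x)/x₂) for all x ∈ (0,∞)²; indeed, (1/p)[D²B(x) − (p−1)·diag(∂₁B(x)/x₁, ∂₂B(x)/x₂)] = (q−p) B(x)^{(p−2q)/p} (x₁x₂)^{q−2} · [[x₂², −x₁x₂],[−x₁x₂, x₁²]], which is negative semidefinite. -/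
noncomputable section
open Real MeasureTheory Matrix Set

theorem HasFDerivAt.pd_eq {ι : Type*} [Fintype ι] [DecidableEq ι] {f : (ι → ℝ) → ℝ}
    {f' : (ι → ℝ) →L[ℝ] ℝ} {x : ι → ℝ} (h : HasFDerivAt f f' x) (i : ι) :
    pd f i x = f' (Pi.single i 1) := by
  rw [pd, h.fderiv]

theorem hasFDerivAt_coord_rpow {ι : Type*} [Fintype ι] (q : ℝ) {x : ι → ℝ} (j : ι)
    (hx : 0 < x j) :
    HasFDerivAt (fun y : ι → ℝ => y j ^ q)
      ((q * x j ^ (q - 1)) • ContinuousLinearMap.proj (R := ℝ) (φ := fun _ : ι => ℝ) j) x :=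
  (ContinuousLinearMap.proj (R := ℝ) (φ := fun _ : ι => ℝ) j).hasFDerivAt.rpow_const
    (Or.inl hx.ne')

theorem sum_rpow_pos {ι : Type*} [Fintype ι] [Nonempty ι] (q : ℝ) {x : ι → ℝ}
    (hx : ∀ j, 0 < x j) : 0 < ∑ j, x j ^ q :=
  Finset.sum_pos (fun j _ => rpow_pos_of_pos (hx j) q) Finset.univ_nonempty

theorem hasFDerivAt_sum_rpow_rpow {ι : Type*} [Fintype ι] [Nonempty ι] (q r : ℝ) {x : ι → ℝ}
    (hx : ∀ j, 0 < x j) :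
    HasFDerivAt (fun y : ι → ℝ => (∑ j, y j ^ q) ^ r)
      ((r * (∑ j, x j ^ q) ^ (r - 1)) • ∑ j, (q * x j ^ (q - 1)) •
        ContinuousLinearMap.proj (R := ℝ) (φ := fun _ : ι => ℝ) j) x :=
  (HasFDerivAt.fun_sum fun j _ => hasFDerivAt_coord_rpow q j (hx j)).rpow_const
    (Or.inl (sum_rpow_pos q hx).ne')

/-- First partial derivatives of `(∑ j, y j ^ q) ^ r` on the positive orthant. -/
theorem pd_sum_rpow_rpow {ι : Type*} [Fintype ι] [DecidableEq ι] [Nonempty ι] (q r : ℝ)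
    {x : ι → ℝ} (hx : ∀ j, 0 < x j) (i : ι) :
    pd (fun y : ι → ℝ => (∑ j, y j ^ q) ^ r) i x =
      r * q * (∑ j, x j ^ q) ^ (r - 1) * x i ^ (q - 1) := by
  rw [(hasFDerivAt_sum_rpow_rpow q r hx).pd_eq]
  simp [_root_.sum_apply, Pi.single_apply]
  ring

/-- Second partial derivatives of `(∑ j, y j ^ q) ^ r` on the positive orthant. -/
theorem hess'_sum_rpow_rpow {ι : Type*} [Fintype ι] [DecidableEq ι] [Nonempty ι] (q r : ℝ)
    {x : ι → ℝ} (hx : ∀ j, 0 < x j) (i j : ι) :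
    hess' (fun y : ι → ℝ => (∑ k, y k ^ q) ^ r) x i j =
      r * q * ((r - 1) * q * (∑ k, x k ^ q) ^ (r - 2) * x i ^ (q - 1) * x j ^ (q - 1) +
        if i = j then (∑ k, x k ^ q) ^ (r - 1) * ((q - 1) * x j ^ (q - 2)) else 0) := by
  have hev : (fun y => pd (fun y : ι → ℝ => (∑ k, y k ^ q) ^ r) j y) =ᶠ[nhds x]
      fun y => r * q * ((∑ k, y k ^ q) ^ (r - 1) * y j ^ (q - 1)) := by
    have hpos : ∀ᶠ y : ι → ℝ in nhds x, ∀ k, 0 < y k :=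
      Filter.eventually_all.2 fun k =>
        (continuous_apply k).continuousAt.eventually (lt_mem_nhds (hx k))
    filter_upwards [hpos] with y hy
    rw [pd_sum_rpow_rpow q r hy, mul_assoc]
  have hd := (((hasFDerivAt_sum_rpow_rpow q (r - 1) hx).mul
    (hasFDerivAt_coord_rpow (q - 1) j (hx j))).const_mul (r * q)).congr_of_eventuallyEq hev
  rw [hess', of_apply, hd.pd_eq, show r - 2 = r - 1 - 1 by ring, show q - 2 = q - 1 - 1 by ring]
  by_cases hij : i = j
  · subst hij
    simp [_root_.sum_apply, Pi.single_apply]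
    ring
  · simp [_root_.sum_apply, Pi.single_apply, hij, Ne.symm hij, -mul_eq_mul_left_iff]
    ring

theorem posSemidef_smul_sq_neg_mul {c : ℝ} (hc : 0 ≤ c) (a b : ℝ) :
    (c • !![b ^ 2, -(a * b); -(a * b), a ^ 2]).PosSemidef := by
  have h : !![b ^ 2, -(a * b); -(a * b), a ^ 2] = vecMulVec ![b, -a] (star ![b, -a]) := by
    ext i j
    fin_cases i <;> fin_cases j <;> simp [vecMulVec_apply] <;> ring
  rw [h]
  exact (posSemidef_vecMulVec_self_star _).smul hc


/-- For `p ≥ max{1,q}`, `q ≠ 0`, the function `B(x₁,x₂) = (x₁^q + x₂^q)^{p/q}` satisfies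
`D²B ≤ (p-1) diag(∂₁B/x₁, ∂₂B/x₂)`, via the stated explicit identity for the difference. -/
theorem lq_norm_power_hessian_bound
    (p q : ℝ) (hp1 : 1 ≤ p) (hpq : q ≤ p) (hq : q ≠ 0)
    (B : (Fin 2 → ℝ) → ℝ)
    (hB : B = fun x => ((x 0) ^ q + (x 1) ^ q) ^ (p / q)) :
    ∀ x : Fin 2 → ℝ, 0 < x 0 → 0 < x 1 →
      ((p - 1) • Matrix.diagonal (fun i => pd B i x / x i) - hess' B x).PosSemidef
      ∧ (1 / p) • (hess' B x - (p - 1) • Matrix.diagonal (fun i => pd B i x / x i))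
          = ((q - p) * (B x) ^ ((p - 2 * q) / p) * (x 0 * x 1) ^ (q - 2)) •
              !![(x 1) ^ (2:ℕ), -(x 0 * x 1); -(x 0 * x 1), (x 0) ^ (2:ℕ)]
      ∧ (-(((q - p) * (B x) ^ ((p - 2 * q) / p) * (x 0 * x 1) ^ (q - 2)) •
              !![(x 1) ^ (2:ℕ), -(x 0 * x 1); -(x 0 * x 1), (x 0) ^ (2:ℕ)])).PosSemidef := by
  intro x hx0 hx1
  have hx : ∀ j, 0 < x j := Fin.forall_fin_two.2 ⟨hx0, hx1⟩
  have hp : 0 < p := one_pos.trans_le hp1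
  have hB' : B = fun y => (∑ j, y j ^ q) ^ (p / q) := by
    simp only [hB, Fin.sum_univ_two]
  have hS := sum_rpow_pos q hx
  have hBx : B x ^ ((p - 2 * q) / p) = (∑ j, x j ^ q) ^ (p / q - 2) := by
    rw [hB', ← rpow_mul hS.le]
    congr 1
    field_simp
  have hS1 : (∑ j, x j ^ q) ^ (p / q - 1) =
      (∑ j, x j ^ q) ^ (p / q - 2) * (x 0 ^ q + x 1 ^ q) := by
    rw [← Fin.sum_univ_two (fun j => x j ^ q), ← rpow_add_one hS.ne']
    ring_nf
  have hpow1 : ∀ j, x j ^ (q - 1) = x j ^ (q - 2) * x j := fun j => by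
    rw [← rpow_add_one (hx j).ne']
    ring_nf
  have hpow : ∀ j, x j ^ q = x j ^ (q - 2) * x j ^ 2 := fun j => by
    rw [← rpow_add_natCast (hx j).ne']
    norm_num
  set M := !![x 1 ^ (2 : ℕ), -(x 0 * x 1); -(x 0 * x 1), x 0 ^ (2 : ℕ)] with hM
  set c := (q - p) * B x ^ ((p - 2 * q) / p) * (x 0 * x 1) ^ (q - 2) with hc
  have hident : (1 / p) •
      (hess' B x - (p - 1) • Matrix.diagonal (fun i => pd B i x / x i)) = c • M := by
    rw [hc, hBx, mul_rpow hx0.le hx1.le]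
    ext i j
    simp only [hB', Matrix.smul_apply, Matrix.sub_apply, hess'_sum_rpow_rpow q (p / q) hx,
      pd_sum_rpow_rpow q (p / q) hx, Matrix.diagonal_apply, smul_eq_mul, hS1]
    generalize (∑ k, x k ^ q) ^ (p / q - 2) = T
    have h0 := hx0.ne'
    have h1 := hx1.ne'
    simp only [hpow1]
    rw [hpow 0, hpow 1]
    fin_cases i <;> fin_cases j <;> simp [hM] <;>
      generalize x 0 ^ (q - 2) = u <;> generalize x 1 ^ (q - 2) = v <;> field_simp <;> ring
  have hc0 : 0 ≤ -c := by
    have : 0 ≤ B x := by rw [hB']; positivity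
    have h : 0 ≤ B x ^ ((p - 2 * q) / p) * (x 0 * x 1) ^ (q - 2) := by positivity
    rw [hc]
    nlinarith [mul_nonneg (sub_nonneg.2 hpq) h]
  have hneg : (-(c • M)).PosSemidef := by
    rw [← neg_smul]
    exact posSemidef_smul_sq_neg_mul hc0 _ _
  refine ⟨?_, hident, hneg⟩
  have := hneg.smul hp.le
  rwa [← hident, smul_neg, smul_smul, mul_one_div_cancel hp.ne', one_smul, neg_sub] at this
end
end

section
/- For each j = 1,…,m let L_j : ℝⁿ → ℝ^{n_j} be a surjective linear transformation, p_j ≥ 0 an exponent, and A_j a symmetric positive-definite linear transformation on ℝ^{n_j}, such that M := Σ_{j=1}^m p_j L_j* A_j L_j is invertible and L_j M⁻¹ L_j* ≤ A_j⁻¹ (as symmetric positive-semidefinite order) for every j. Let u_j : (0,∞) × ℝ^{n_j} → (0,∞) be smooth with ∂_t u_j ≥ div(A_j⁻¹∇u_j) and D²(log u_j) ≥ −A_j/(2t) pointwise for all j. Then ũ(t,x) := t^{(Σ_j p_j n_j − n)/2} ∏_{j=1}^m u_j(t, L_j x)^{p_j} satisfies ∂_t ũ ≥ div(M⁻¹∇ũ)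 and D²(log ũ) ≥ −M/(2t) pointwise on (0,∞) × ℝⁿ. -/
noncomputable section
open Real MeasureTheory Matrix Set

section MatrixInequalities

variable {ι : Type*} [Fintype ι]

open scoped MatrixOrder in
lemma Matrix.PosSemidef.exists_eq_transpose_mul_self {Q : Matrix ι ι ℝ}
    (hQ : Q.PosSemidef) : ∃ C : Matrix ι ι ℝ, Q = Cᵀ * C := by
  classical
  obtain ⟨C, hC⟩ := CStarAlgebra.nonneg_iff_eq_star_mul_self.mp hQ.nonneg
  exact ⟨C, by simpa [Matrix.star_eq_conjTranspose] using hC⟩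

lemma Matrix.PosSemidef.trace_mul_nonneg {P Q : Matrix ι ι ℝ}
    (hP : P.PosSemidef) (hQ : Q.PosSemidef) : 0 ≤ (P * Q).trace := by
  obtain ⟨C, rfl⟩ := hQ.exists_eq_transpose_mul_self
  rw [← Matrix.mul_assoc, Matrix.trace_mul_comm, ← Matrix.mul_assoc]
  simpa using (hP.mul_mul_conjTranspose_same C).trace_nonneg

/-- Fenchel's inequality `2 ⟨z, g⟩ ≤ ⟨z, A z⟩ + ⟨g, A⁻¹ g⟩`. -/
lemma Matrix.PosDef.two_mul_dotProduct_le [DecidableEq ι] {A : Matrix ι ι ℝ} (hA : A.PosDef)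
    (z g : ι → ℝ) : 2 * (z ⬝ᵥ g) ≤ z ⬝ᵥ A *ᵥ z + g ⬝ᵥ A⁻¹ *ᵥ g := by
  have hdet : IsUnit A.det := (Matrix.isUnit_iff_isUnit_det A).mp hA.isUnit
  have hAt : Aᵀ = A := by simpa using hA.isHermitian.eq
  have h := hA.posSemidef.dotProduct_mulVec_nonneg (z - A⁻¹ *ᵥ g)
  have h1 : A *ᵥ (A⁻¹ *ᵥ g) = g := by
    rw [Matrix.mulVec_mulVec, Matrix.mul_nonsing_inv _ hdet, Matrix.one_mulVec]
  have h2 : (A⁻¹ *ᵥ g) ⬝ᵥ A *ᵥ z = g ⬝ᵥ z := by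
    rw [Matrix.dotProduct_mulVec, ← Matrix.mulVec_transpose, hAt, h1]
  rw [star_trivial, Matrix.mulVec_sub, h1, sub_dotProduct, dotProduct_sub, dotProduct_sub, h2,
    dotProduct_comm g z, dotProduct_comm (A⁻¹ *ᵥ g) g] at h
  linarith

variable {σ : Type*} [Fintype σ] {d : σ → Type*} [∀ j, Fintype (d j)] [∀ j, DecidableEq (d j)]
  [DecidableEq ι]

lemma dotProduct_inv_mulVec_sum_le (L : ∀ j, Matrix (d j) ι ℝ) (p : σ → ℝ) (hp : ∀ j, 0 ≤ p j)
    (A : ∀ j, Matrix (d j) (d j) ℝ) (hA : ∀ j, (A j).PosDef) (M : Matrix ι ι ℝ)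
    (hM : M = ∑ j, p j • ((L j)ᵀ * A j * L j)) (hM_inv : IsUnit M.det) (g : ∀ j, d j → ℝ) :
    (∑ j, p j • ((L j)ᵀ *ᵥ g j)) ⬝ᵥ M⁻¹ *ᵥ (∑ j, p j • ((L j)ᵀ *ᵥ g j)) ≤
      ∑ j, p j * (g j ⬝ᵥ (A j)⁻¹ *ᵥ g j) := by
  set G := ∑ j, p j • ((L j)ᵀ *ᵥ g j) with hG
  set y := M⁻¹ *ᵥ G with hy
  have hMy : M *ᵥ y = G := by
    rw [hy, Matrix.mulVec_mulVec, Matrix.mul_nonsing_inv _ hM_inv, Matrix.one_mulVec]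
  have h1 : y ⬝ᵥ M *ᵥ y = ∑ j, p j * ((L j *ᵥ y) ⬝ᵥ A j *ᵥ (L j *ᵥ y)) := by
    rw [hM, Matrix.sum_mulVec, dotProduct_sum]
    refine Finset.sum_congr rfl fun j _ => ?_
    rw [Matrix.smul_mulVec, dotProduct_smul, smul_eq_mul, Matrix.mul_assoc,
      ← Matrix.mulVec_mulVec, Matrix.dotProduct_mulVec, Matrix.vecMul_transpose,
      ← Matrix.mulVec_mulVec]
  have h2 : y ⬝ᵥ G = ∑ j, p j * ((L j *ᵥ y) ⬝ᵥ g j) := by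
    rw [hG, dotProduct_sum]
    refine Finset.sum_congr rfl fun j _ => ?_
    rw [dotProduct_smul, smul_eq_mul, Matrix.dotProduct_mulVec, Matrix.vecMul_transpose]
  have h3 : 2 * (y ⬝ᵥ G) ≤ y ⬝ᵥ M *ᵥ y + ∑ j, p j * (g j ⬝ᵥ (A j)⁻¹ *ᵥ g j) := by
    rw [h1, h2, Finset.mul_sum, ← Finset.sum_add_distrib]
    refine Finset.sum_le_sum fun j _ => ?_
    have := mul_le_mul_of_nonneg_left ((hA j).two_mul_dotProduct_le (L j *ᵥ y) (g j)) (hp j)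
    linarith
  rw [hMy] at h3
  rw [dotProduct_comm]
  linarith

lemma trace_inv_mul_sum_le (L : ∀ j, Matrix (d j) ι ℝ) (p : σ → ℝ) (hp : ∀ j, 0 ≤ p j)
    (A : ∀ j, Matrix (d j) (d j) ℝ) (hA : ∀ j, (A j).PosDef) (M : Matrix ι ι ℝ)
    (hM : M = ∑ j, p j • ((L j)ᵀ * A j * L j)) (hM_inv : IsUnit M.det)
    (hBL : ∀ j, ((A j)⁻¹ - L j * M⁻¹ * (L j)ᵀ).PosSemidef) (H : ∀ j, Matrix (d j) (d j) ℝ)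
    (c : ℝ) (hH : ∀ j, (H j + c • A j).PosSemidef) :
    (M⁻¹ * ∑ j, p j • ((L j)ᵀ * H j * L j)).trace ≤
      ∑ j, p j * ((A j)⁻¹ * H j).trace
        + c * ((∑ j, p j * Fintype.card (d j)) - Fintype.card ι) := by
  have hexp (X : ∀ j, Matrix (d j) (d j) ℝ) :
      (M⁻¹ * ∑ j, p j • ((L j)ᵀ * X j * L j)).trace =
        ∑ j, p j * (L j * M⁻¹ * (L j)ᵀ * X j).trace := by
    rw [Matrix.mul_sum, Matrix.trace_sum]
    refine Finset.sum_congr rfl fun j _ => ?_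
    rw [Matrix.mul_smul, Matrix.trace_smul, smul_eq_mul, ← Matrix.mul_assoc, Matrix.trace_mul_comm,
      ← Matrix.mul_assoc, ← Matrix.mul_assoc]
  have hn : (Fintype.card ι : ℝ) = ∑ j, p j * (L j * M⁻¹ * (L j)ᵀ * A j).trace := by
    rw [← hexp, ← hM, Matrix.nonsing_inv_mul _ hM_inv, Matrix.trace_one]
  rw [hexp, hn, ← Finset.sum_sub_distrib, Finset.mul_sum, ← Finset.sum_add_distrib]
  refine Finset.sum_le_sum fun j _ => ?_
  have h := mul_nonneg (hp j) ((hBL j).trace_mul_nonneg (hH j))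
  have hdet : IsUnit (A j).det := (Matrix.isUnit_iff_isUnit_det _).mp (hA j).isUnit
  rw [Matrix.sub_mul, Matrix.mul_add, Matrix.mul_add, Matrix.mul_smul, Matrix.mul_smul,
    Matrix.nonsing_inv_mul _ hdet, Matrix.trace_sub, Matrix.trace_add, Matrix.trace_add,
    Matrix.trace_smul, Matrix.trace_smul, Matrix.trace_one, smul_eq_mul, smul_eq_mul] at h
  linarith

end MatrixInequalities

section Calculus

variable {ι κ : Type*} [Fintype ι] [DecidableEq ι] [Fintype κ] [DecidableEq κ]

lemma ContDiff.differentiable_pd {f : (ι → ℝ) → ℝ} (hf : ContDiff ℝ 2 f) (i : ι) :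
    Differentiable ℝ (pd f i) := by
  have h : ContDiff ℝ 1 (fderiv ℝ f) := hf.fderiv_right (by norm_num)
  exact (h.clm_apply contDiff_const).differentiable (by norm_num)

lemma pd_exp {f : (ι → ℝ) → ℝ} (hf : Differentiable ℝ f) (i : ι) (x : ι → ℝ) :
    pd (fun y => Real.exp (f y)) i x = Real.exp (f x) * pd f i x := by
  simp [pd, fderiv_exp (hf x)]

lemma pd_const_add_sum {σ : Type*} [Fintype σ] {f : σ → (ι → ℝ) → ℝ}
    (hf : ∀ j, Differentiable ℝ (f j)) (a : ℝ) (p : σ → ℝ) (i : ι) (x : ι → ℝ) :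
    pd (fun y => a + ∑ j, p j * f j y) i x = ∑ j, p j * pd (f j) i x := by
  have h : HasFDerivAt (fun y => a + ∑ j, p j * f j y) (∑ j, p j • fderiv ℝ (f j) x) x :=
    (HasFDerivAt.fun_sum fun j _ => ((hf j x).hasFDerivAt.const_mul (p j))).const_add a
  simp [pd, h.fderiv, _root_.sum_apply]

lemma pd_comp_mulVec {f : (κ → ℝ) → ℝ} (hf : Differentiable ℝ f) (L : Matrix κ ι ℝ) (i : ι)
    (x : ι → ℝ) : pd (fun y => f (L *ᵥ y)) i x = ∑ k, L k i * pd f k (L *ᵥ x) := by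
  have hL : HasFDerivAt (fun y => L *ᵥ y) (LinearMap.toContinuousLinearMap L.mulVecLin) x :=
    (LinearMap.toContinuousLinearMap L.mulVecLin).hasFDerivAt
  have h := (hf (L *ᵥ x)).hasFDerivAt.comp x hL
  rw [pd, show (fun y => f (L *ᵥ y)) = f ∘ fun y => L *ᵥ y from rfl, h.fderiv]
  have hcol : L *ᵥ Pi.single i 1 = ∑ k, L k i • (Pi.single k 1 : κ → ℝ) := by
    ext k
    simp [Finset.sum_apply, Pi.single_apply]
  simp only [ContinuousLinearMap.comp_apply, LinearMap.coe_toContinuousLinearMap',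
    Matrix.mulVecLin_apply, hcol, map_sum, map_smul, smul_eq_mul, pd]

lemma grad'_const_add_sum_comp {σ : Type*} [Fintype σ] {d : σ → Type*} [∀ j, Fintype (d j)]
    [∀ j, DecidableEq (d j)] {f : ∀ j, (d j → ℝ) → ℝ} (hf : ∀ j, Differentiable ℝ (f j))
    (L : ∀ j, Matrix (d j) ι ℝ) (a : ℝ) (p : σ → ℝ) (x : ι → ℝ) :
    grad' (fun y => a + ∑ j, p j * f j (L j *ᵥ y)) x =
      ∑ j, p j • ((L j)ᵀ *ᵥ grad' (f j) (L j *ᵥ x)) := by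
  ext i
  have hd (j : σ) : Differentiable ℝ fun y => f j (L j *ᵥ y) :=
    (hf j).comp (LinearMap.toContinuousLinearMap (L j).mulVecLin).differentiable
  simp [grad', pd_const_add_sum hd, pd_comp_mulVec (hf _), Finset.sum_apply, Matrix.mulVec,
    dotProduct]

lemma hess'_const_add_sum_comp {σ : Type*} [Fintype σ] {d : σ → Type*} [∀ j, Fintype (d j)]
    [∀ j, DecidableEq (d j)] {f : ∀ j, (d j → ℝ) → ℝ} (hf : ∀ j, ContDiff ℝ 2 (f j))
    (L : ∀ j, Matrix (d j) ι ℝ) (a : ℝ) (p : σ → ℝ) (x : ι → ℝ) :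
    hess' (fun y => a + ∑ j, p j * f j (L j *ᵥ y)) x =
      ∑ j, p j • ((L j)ᵀ * hess' (f j) (L j *ᵥ x) * L j) := by
  have hdf (j : σ) : Differentiable ℝ (f j) := (hf j).differentiable (by norm_num)
  have hL (j : σ) : Differentiable ℝ fun y => L j *ᵥ y :=
    (LinearMap.toContinuousLinearMap (L j).mulVecLin).differentiable
  ext i k
  have hpd : pd (fun y => a + ∑ j, p j * f j (L j *ᵥ y)) k =
      fun y => 0 + ∑ j, p j * (0 + ∑ l, L j l k * pd (f j) l (L j *ᵥ y)) := by
    ext y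
    rw [pd_const_add_sum (f := fun j y => f j (L j *ᵥ y)) fun j => (hdf j).comp (hL j)]
    simp [pd_comp_mulVec (hdf _)]
  have hd (j : σ) (l : d j) : Differentiable ℝ fun y => pd (f j) l (L j *ᵥ y) :=
    ((hf j).differentiable_pd l).comp (hL j)
  rw [hess', Matrix.of_apply, hpd,
    pd_const_add_sum (f := fun j y => 0 + ∑ l, L j l k * pd (f j) l (L j *ᵥ y)) fun j =>
      (differentiable_const _).add (Differentiable.fun_sum fun l _ => (hd j l).const_mul _)]
  simp only [Matrix.sum_apply, Matrix.smul_apply, smul_eq_mul]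
  refine Finset.sum_congr rfl fun j _ => ?_
  rw [pd_const_add_sum fun l => hd j l]
  simp only [pd_comp_mulVec ((hf j).differentiable_pd _), Matrix.mul_apply, Matrix.transpose_apply,
    hess', Matrix.of_apply]
  congr 1
  exact Finset.sum_congr rfl fun l _ => mul_comm _ _

lemma div'_mulVec_grad'_exp {f : (ι → ℝ) → ℝ} (hf : ContDiff ℝ 2 f) (B : Matrix ι ι ℝ)
    (x : ι → ℝ) :
    div' (fun y => B *ᵥ grad' (fun z => Real.exp (f z)) y) x =
      Real.exp (f x) * ((Bᵀ * hess' f x).trace + grad' f x ⬝ᵥ B *ᵥ grad' f x) := by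
  have hdf : Differentiable ℝ f := hf.differentiable (by norm_num)
  have hprod (i j : ι) : pd (fun y => Real.exp (f y) * pd f j y) i x =
      Real.exp (f x) * (pd (fun y => pd f j y) i x + pd f i x * pd f j x) := by
    have h := (hdf x).hasFDerivAt.exp.fun_mul (hf.differentiable_pd j x).hasFDerivAt
    rw [pd, h.fderiv]
    change Real.exp (f x) * pd (pd f j) i x + pd f j x * (Real.exp (f x) * pd f i x) =
      Real.exp (f x) * (pd (pd f j) i x + pd f i x * pd f j x)
    ring
  have hd (j : ι) : Differentiable ℝ fun y => Real.exp (f y) * pd f j y :=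
    hdf.exp.mul (hf.differentiable_pd j)
  have hrow (i : ι) : pd (fun y => (B *ᵥ grad' (fun z => Real.exp (f z)) y) i) i x =
      ∑ j, B i j * (Real.exp (f x) * (pd (fun y => pd f j y) i x + pd f i x * pd f j x)) := by
    have : (fun y => (B *ᵥ grad' (fun z => Real.exp (f z)) y) i) =
        fun y => 0 + ∑ j, B i j * (Real.exp (f y) * pd f j y) := by
      ext y
      simp [Matrix.mulVec, dotProduct, grad', pd_exp hdf]
    rw [this, pd_const_add_sum hd]
    simp only [hprod]
  simp only [div', hrow]
  have htr : (Bᵀ * hess' f x).trace = ∑ i, ∑ j, B i j * pd (fun y => pd f j y) i x := by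
    simp only [Matrix.trace, Matrix.diag, Matrix.mul_apply, Matrix.transpose_apply, hess',
      Matrix.of_apply]
    exact Finset.sum_comm
  have hq : grad' f x ⬝ᵥ B *ᵥ grad' f x = ∑ i, ∑ j, B i j * (pd f i x * pd f j x) := by
    simp only [dotProduct, Matrix.mulVec, grad', Finset.mul_sum]
    exact Finset.sum_congr rfl fun i _ => Finset.sum_congr rfl fun j _ => by ring
  rw [htr, hq, ← Finset.sum_add_distrib, Finset.mul_sum]
  refine Finset.sum_congr rfl fun i _ => ?_
  rw [← Finset.sum_add_distrib, Finset.mul_sum]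
  exact Finset.sum_congr rfl fun j _ => by ring

end Calculus

/-- Closure of the system (heat supersolution + matrix Li–Yau estimate) under anisotropic
geometric means with the Brascamp–Lieb data satisfying `L_jM⁻¹L_j* ≤ A_j⁻¹`. -/
theorem anisotropic_geometric_mean_LiYau_closure
    {n m : ℕ} (d : Fin m → ℕ)
    (L : ∀ j, Matrix (Fin (d j)) (Fin n) ℝ)
    (hL_surj : ∀ j, Function.Surjective (fun x => (L j).mulVec x))
    (p : Fin m → ℝ) (hp : ∀ j, 0 ≤ p j)
    (A : ∀ j, Matrix (Fin (d j)) (Fin (d j)) ℝ) (hA : ∀ j, (A j).PosDef)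
    (M : Matrix (Fin n) (Fin n) ℝ)
    (hM : M = ∑ j, p j • ((L j)ᵀ * A j * L j))
    (hM_inv : IsUnit M.det)
    (hBL : ∀ j, ((A j)⁻¹ - L j * M⁻¹ * (L j)ᵀ).PosSemidef)
    (u : ∀ j, ℝ → (Fin (d j) → ℝ) → ℝ)
    (hu_smooth : ∀ j, ContDiffOn ℝ (⊤ : ℕ∞) (Function.uncurry (u j)) (Set.Ioi (0:ℝ) ×ˢ Set.univ))
    (hu_pos : ∀ j, ∀ t > (0:ℝ), ∀ x, 0 < u j t x)
    (hu_super : ∀ j, ∀ t > (0:ℝ), ∀ x,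
      deriv (fun s => u j s x) t ≥ div' (fun y => (A j)⁻¹.mulVec (grad' (u j t) y)) x)
    (hu_LiYau : ∀ j, ∀ t > (0:ℝ), ∀ x,
      (hess' (fun y => Real.log (u j t y)) x + (1 / (2 * t)) • (A j)).PosSemidef)
    (util : ℝ → (Fin n → ℝ) → ℝ)
    (hutil : util = fun t x =>
      t ^ (((∑ j, p j * d j) - n) / 2) * ∏ j, (u j t ((L j).mulVec x)) ^ (p j)) :
    (∀ t > (0:ℝ), ∀ x,
      deriv (fun s => util s x) t ≥ div' (fun y => M⁻¹.mulVec (grad' (util t) y)) x)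
    ∧ (∀ t > (0:ℝ), ∀ x,
      (hess' (fun y => Real.log (util t y)) x + (1 / (2 * t)) • M).PosSemidef) := by
  have hcard : (∑ j, p j * d j) - n =
      (∑ j, p j * Fintype.card (Fin (d j))) - Fintype.card (Fin n) := by simp
  set α : ℝ := ((∑ j, p j * d j) - n) / 2 with hα
  have hsmooth (j : Fin m) {t : ℝ} (ht : 0 < t) : ContDiff ℝ 2 fun y => Real.log (u j t y) := by
    refine ContDiff.log ?_ fun y => (hu_pos j t ht y).ne'
    have h := (hu_smooth j).comp_contDiff (f := fun y => (t, y))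
      (contDiff_const.prodMk contDiff_id) (fun y => ⟨ht, mem_univ y⟩)
    exact h.of_le (WithTop.coe_le_coe.mpr le_top)
  have hdt (j : Fin m) {t : ℝ} (ht : 0 < t) (y : Fin (d j) → ℝ) :
      DifferentiableAt ℝ (fun s => u j s y) t := by
    have hopen : IsOpen (Set.Ioi (0 : ℝ) ×ˢ (Set.univ : Set (Fin (d j) → ℝ))) :=
      isOpen_Ioi.prod isOpen_univ
    have h : DifferentiableAt ℝ (Function.uncurry (u j)) (t, y) :=
      ((hu_smooth j).contDiffAt (hopen.mem_nhds (Set.mk_mem_prod ht (mem_univ y)))).differentiableAt (by simp)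
    exact h.comp t (f := fun s => (s, y)) (differentiableAt_id.prodMk (differentiableAt_const y))
  have hexp {t : ℝ} (ht : 0 < t) (x : Fin n → ℝ) :
      util t x = Real.exp (α * Real.log t + ∑ j, p j * Real.log (u j t (L j *ᵥ x))) := by
    simp only [hutil]
    rw [Real.exp_add, Real.exp_sum, Real.rpow_def_of_pos ht, mul_comm (Real.log t)]
    congr 1
    refine Finset.prod_congr rfl fun j _ => ?_
    rw [Real.rpow_def_of_pos (hu_pos j t ht _), mul_comm]
  have hMt : (M⁻¹)ᵀ = M⁻¹ := by
    rw [Matrix.transpose_nonsing_inv, hM]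
    simp only [Matrix.transpose_sum, Matrix.transpose_smul, Matrix.transpose_mul,
      Matrix.transpose_transpose, Matrix.mul_assoc]
    simp only [fun j => show (A j)ᵀ = A j by simpa using (hA j).isHermitian.eq]
  have hAt (j : Fin m) : ((A j)⁻¹)ᵀ = (A j)⁻¹ := by
    simpa using (hA j).inv.isHermitian.eq
  have hlog_super (j : Fin m) {t : ℝ} (ht : 0 < t) (y : Fin (d j) → ℝ) :
      ((A j)⁻¹ * hess' (fun z => Real.log (u j t z)) y).trace
        + grad' (fun z => Real.log (u j t z)) y ⬝ᵥ
          (A j)⁻¹ *ᵥ grad' (fun z => Real.log (u j t z)) y ≤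
        deriv (fun s => u j s y) t / u j t y := by
    have h := hu_super j t ht y
    have hu : u j t = fun z => Real.exp (Real.log (u j t z)) :=
      funext fun z => (Real.exp_log (hu_pos j t ht z)).symm
    rw [hu, div'_mulVec_grad'_exp (hsmooth j ht), Real.exp_log (hu_pos j t ht y), hAt] at h
    rw [le_div_iff₀ (hu_pos j t ht y), mul_comm]
    exact h
  refine ⟨fun t ht x => ?_, fun t ht x => ?_⟩
  · have hV : ContDiff ℝ 2 fun y => α * Real.log t + ∑ j, p j * Real.log (u j t (L j *ᵥ y)) :=
      contDiff_const.add (ContDiff.sum fun j _ => contDiff_const.mul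
        ((hsmooth j ht).comp (LinearMap.toContinuousLinearMap (L j).mulVecLin).contDiff))
    have hderiv : HasDerivAt (fun s => util s x)
        (Real.exp (α * Real.log t + ∑ j, p j * Real.log (u j t (L j *ᵥ x))) *
          (α * t⁻¹ + ∑ j, p j * (deriv (fun s => u j s (L j *ᵥ x)) t / u j t (L j *ᵥ x)))) t := by
      refine HasDerivAt.congr_of_eventuallyEq ?_
        (Filter.eventually_of_mem (Ioi_mem_nhds ht) fun s hs => hexp hs x)
      exact (((Real.hasDerivAt_log ht.ne').const_mul α).add (HasDerivAt.fun_sum fun j _ =>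
        ((hdt j ht _).hasDerivAt.log (hu_pos j t ht _).ne').const_mul (p j))).exp
    rw [hderiv.deriv, show util t = _ from funext (hexp ht), div'_mulVec_grad'_exp hV, hMt]
    refine mul_le_mul_of_nonneg_left ?_ (Real.exp_pos _).le
    rw [hess'_const_add_sum_comp fun j => hsmooth j ht,
      grad'_const_add_sum_comp fun j => (hsmooth j ht).differentiable (by norm_num)]
    have htr := trace_inv_mul_sum_le L p hp A hA M hM hM_inv hBL _ (1 / (2 * t))
      fun j => hu_LiYau j t ht (L j *ᵥ x)
    have hquad := dotProduct_inv_mulVec_sum_le L p hp A hA M hM hM_inv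
      fun j => grad' (fun y => Real.log (u j t y)) (L j *ᵥ x)
    have hsum := Finset.sum_le_sum fun j (_ : j ∈ Finset.univ) =>
      mul_le_mul_of_nonneg_left (hlog_super j ht (L j *ᵥ x)) (hp j)
    simp only [mul_add, Finset.sum_add_distrib] at hsum
    have hαt : 1 / (2 * t) * ((∑ j, p j * Fintype.card (Fin (d j))) - Fintype.card (Fin n)) =
        α * t⁻¹ := by
      rw [← hcard, hα]
      field_simp
    linarith
  · have hlog : (fun y => Real.log (util t y)) =
        fun y => α * Real.log t + ∑ j, p j * Real.log (u j t (L j *ᵥ y)) :=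
      funext fun y => by rw [hexp ht, Real.log_exp]
    rw [hlog, hess'_const_add_sum_comp fun j => hsmooth j ht, hM, Finset.smul_sum,
      ← Finset.sum_add_distrib]
    refine Matrix.posSemidef_sum _ fun j _ => ?_
    have h := ((hu_LiYau j t ht (L j *ᵥ x)).conjTranspose_mul_mul_same (L j)).smul (hp j)
    rw [Matrix.conjTranspose_eq_transpose_of_trivial, Matrix.mul_add, Matrix.add_mul,
      Matrix.mul_smul, Matrix.smul_mul, smul_add, smul_comm (p j)] at h
    exact h
end
end

section
/- Let n ≥ 1, let p, p₁, p₂ ∈ [1,∞) satisfy 1/p₁ + 1/p₂ = 1 + 1/p, and let σ, σ₁, σ₂ ≥ 0 satisfy σ₁ p₂ p₂' = σ₂ p₁ p₁' and σp = σ₁p₁ + σ₂p₂, where p_j' is the conjugate exponent of p_j. Let u₁, u₂ : (0,∞) × ℝⁿ → (0,∞) be smooth and such that the convolution ũ^{1/p} := u₁^{1/p₁} * u₂^{1/p₂} (convolution in the spatial variable) is well defined and sufficiently regular, with differentiation under the convolution integral valid. If D²(log u_j) ≥ −I/(2σ_j t) pointwise for j = 1, 2, then D²(log ũ) ≥ −I/(2σt)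 pointwise, where I is the identity matrix on ℝⁿ. -/
noncomputable section
open Real MeasureTheory Matrix Set

/-- Hölder conjugate exponent. -/
def conjExp (r : ℝ) : ℝ := r / (r - 1)

/-- The Hessian matrix represents the second Fréchet derivative. -/
lemma hess'_apply {n : ℕ} {f : (Fin n → ℝ) → ℝ} (hf : ContDiff ℝ 2 f) (x : Fin n → ℝ)
    (i j : Fin n) :
    hess' f x i j = fderiv ℝ (fderiv ℝ f) x (Pi.single i 1) (Pi.single j 1) := by
  have h : DifferentiableAt ℝ (fderiv ℝ f) x :=
    (hf.fderiv_right (m := 1) (by norm_num)).differentiable one_ne_zero x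
  simp only [hess', pd, Matrix.of_apply]
  rw [fderiv_clm_apply h (differentiableAt_const _)]
  simp

lemma dotProduct_hess'_mulVec {n : ℕ} {f : (Fin n → ℝ) → ℝ} (hf : ContDiff ℝ 2 f)
    (x w : Fin n → ℝ) :
    w ⬝ᵥ (hess' f x *ᵥ w) = fderiv ℝ (fderiv ℝ f) x w w := by
  have hw : w = ∑ i, w i • (Pi.single i (1 : ℝ) : Fin n → ℝ) := by
    simp [← Pi.single_smul, Finset.univ_sum_single]
  conv_rhs => rw [hw]
  simp only [map_sum, map_smul, _root_.sum_apply,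
    _root_.smul_apply, smul_eq_mul, dotProduct, mulVec, hess'_apply hf,
    Finset.mul_sum]
  rw [Finset.sum_comm]
  refine Finset.sum_congr rfl fun i _ => Finset.sum_congr rfl fun j _ => ?_
  ring

lemma posSemidef_hess'_add_smul_one_iff {n : ℕ} {f : (Fin n → ℝ) → ℝ} (hf : ContDiff ℝ 2 f)
    (c : ℝ) (x : Fin n → ℝ) :
    (hess' f x + c • (1 : Matrix (Fin n) (Fin n) ℝ)).PosSemidef ↔
      ∀ w, 0 ≤ fderiv ℝ (fderiv ℝ f) x w w + c * (w ⬝ᵥ w) := by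
  have key : ∀ w : Fin n → ℝ,
      star w ⬝ᵥ ((hess' f x + c • (1 : Matrix (Fin n) (Fin n) ℝ)) *ᵥ w)
        = fderiv ℝ (fderiv ℝ f) x w w + c * (w ⬝ᵥ w) := by
    intro w
    rw [← dotProduct_hess'_mulVec hf]
    simp [add_mulVec, smul_mulVec, dotProduct_add]
  constructor
  · intro h w
    rw [← key]
    exact h.dotProduct_mulVec_nonneg w
  · intro h
    refine .of_dotProduct_mulVec_nonneg (IsHermitian.ext fun i j => ?_) fun w => ?_
    · have hs := (hf.contDiffAt (x := x)).isSymmSndFDerivAt (by simp)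
      simp only [Matrix.add_apply, Matrix.smul_apply, star_trivial, hess'_apply hf,
        hs.eq (Pi.single i 1) (Pi.single j 1), Matrix.one_apply, eq_comm (a := i)]
    · rw [key]
      exact h w

lemma hasDerivAt_comp_line {n : ℕ} {f : (Fin n → ℝ) → ℝ} (hf : ContDiff ℝ 2 f)
    (x w : Fin n → ℝ) (s : ℝ) :
    HasDerivAt (fun s : ℝ => f (x + s • w)) (fderiv ℝ f (x + s • w) w) s := by
  have hl : HasDerivAt (fun s : ℝ => x + s • w) w s := by
    simpa using ((hasDerivAt_id s).smul_const w).const_add x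
  exact ((hf.differentiable two_ne_zero) _).hasFDerivAt.comp_hasDerivAt s hl

lemma hasDerivAt_fderiv_comp_line {n : ℕ} {f : (Fin n → ℝ) → ℝ} (hf : ContDiff ℝ 2 f)
    (x w : Fin n → ℝ) (s : ℝ) :
    HasDerivAt (fun s : ℝ => fderiv ℝ f (x + s • w) w)
      (fderiv ℝ (fderiv ℝ f) (x + s • w) w w) s := by
  have hl : HasDerivAt (fun s : ℝ => x + s • w) w s := by
    simpa using ((hasDerivAt_id s).smul_const w).const_add x
  have h : Differentiable ℝ (fderiv ℝ f) :=
    (hf.fderiv_right (m := 1) (by norm_num)).differentiable one_ne_zero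
  simpa using ((h _).hasFDerivAt.comp_hasDerivAt s hl).clm_apply (hasDerivAt_const s w)

/-- A lower Hessian bound implies the corresponding midpoint inequality. -/
lemma two_mul_le_of_posSemidef_hess' {n : ℕ} {f : (Fin n → ℝ) → ℝ} (hf : ContDiff ℝ 2 f)
    {c : ℝ} (h : ∀ x, (hess' f x + c • (1 : Matrix (Fin n) (Fin n) ℝ)).PosSemidef)
    (x w : Fin n → ℝ) :
    2 * f x ≤ f (x + w) + f (x - w) + c * (w ⬝ᵥ w) := by
  set q := w ⬝ᵥ w
  have d1 : ∀ s : ℝ, HasDerivAt (fun s : ℝ => f (x + s • w) + c * q / 2 * s ^ 2)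
      (fderiv ℝ f (x + s • w) w + c * q * s) s := fun s => by
    refine ((hasDerivAt_comp_line hf x w s).fun_add
      ((hasDerivAt_pow 2 s).const_mul (c * q / 2))).congr_deriv ?_
    push_cast
    ring
  have d2 : ∀ s : ℝ, HasDerivAt (fun s : ℝ => fderiv ℝ f (x + s • w) w + c * q * s)
      (fderiv ℝ (fderiv ℝ f) (x + s • w) w w + c * q) s := fun s => by
    refine ((hasDerivAt_fderiv_comp_line hf x w s).fun_add
      ((hasDerivAt_id' s).const_mul (c * q))).congr_deriv ?_
    rw [mul_one]
  have e1 := funext fun s => (d1 s).deriv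
  have hc : ConvexOn ℝ univ (fun s : ℝ => f (x + s • w) + c * q / 2 * s ^ 2) := by
    refine convexOn_univ_of_deriv2_nonneg (fun s => (d1 s).differentiableAt) ?_ fun s => ?_
    · rw [e1]
      exact fun s => (d2 s).differentiableAt
    · rw [Function.iterate_succ, Function.iterate_one, Function.comp_apply, e1, (d2 s).deriv]
      exact (posSemidef_hess'_add_smul_one_iff hf c _).1 (h _) w
  have := hc.2 (mem_univ (1 : ℝ)) (mem_univ (-1 : ℝ)) (by norm_num : (0 : ℝ) ≤ 1 / 2)
    (by norm_num : (0 : ℝ) ≤ 1 / 2) (by norm_num)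
  norm_num [← sub_eq_add_neg] at this
  linarith

/-- The midpoint inequality implies the corresponding lower Hessian bound. -/
lemma posSemidef_hess'_of_two_mul_le {n : ℕ} {f : (Fin n → ℝ) → ℝ} (hf : ContDiff ℝ 2 f)
    {c : ℝ} {x : Fin n → ℝ}
    (h : ∀ w, 2 * f x ≤ f (x + w) + f (x - w) + c * (w ⬝ᵥ w)) :
    (hess' f x + c • (1 : Matrix (Fin n) (Fin n) ℝ)).PosSemidef := by
  rw [posSemidef_hess'_add_smul_one_iff hf]
  intro w
  set q := w ⬝ᵥ w with hq
  by_contra! hneg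
  set ψ : ℝ → ℝ := fun s => f (x + s • w) + f (x + (-s) • w) + c * q * s ^ 2 with hψ
  have d1 : ∀ s : ℝ, HasDerivAt ψ
      (fderiv ℝ f (x + s • w) w - fderiv ℝ f (x + (-s) • w) w + 2 * (c * q) * s) s := fun s => by
    refine (((hasDerivAt_comp_line hf x w s).fun_add
      ((hasDerivAt_comp_line hf x w (-s)).comp s (hasDerivAt_neg s))).fun_add
      ((hasDerivAt_pow 2 s).const_mul (c * q))).congr_deriv ?_
    push_cast
    ring
  have d2 : HasDerivAt (fun s : ℝ => fderiv ℝ f (x + s • w) w - fderiv ℝ f (x + (-s) • w) w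
      + 2 * (c * q) * s) (2 * (fderiv ℝ (fderiv ℝ f) x w w + c * q)) 0 := by
    refine (((hasDerivAt_fderiv_comp_line hf x w 0).fun_sub
      ((hasDerivAt_fderiv_comp_line hf x w (-0)).comp 0 (hasDerivAt_neg 0))).fun_add
      ((hasDerivAt_id' (0 : ℝ)).const_mul (2 * (c * q)))).congr_deriv ?_
    simp only [neg_zero, zero_smul, add_zero]
    ring
  have e1 := funext fun s => (d1 s).deriv
  have hdd : deriv (deriv ψ) 0 = 2 * (fderiv ℝ (fderiv ℝ f) x w w + c * q) := by
    rw [e1, d2.deriv]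
  have hmax : IsLocalMax ψ 0 :=
    isLocalMax_of_deriv_deriv_neg (by rw [hdd]; linarith) (by rw [e1]; simp)
      (d1 0).continuousAt
  have hmin : ∀ s, ψ 0 ≤ ψ s := fun s => by
    have := h (s • w)
    simp only [smul_dotProduct, dotProduct_smul, smul_eq_mul, ← hq] at this
    simp only [hψ, zero_smul, add_zero, neg_smul, ← sub_eq_add_neg]
    simp only [sub_zero]
    nlinarith
  have hconst : ψ =ᶠ[nhds 0] fun _ => ψ 0 := hmax.mono fun s hs => le_antisymm hs (hmin s)
  have : deriv (deriv ψ) 0 = 0 := by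
    rw [hconst.deriv.deriv_eq]
    simp
  linarith

/-- Midpoint log-semiconvexity is inherited by convolutions. -/
lemma two_mul_log_integral_le {n : ℕ} {f g v : (Fin n → ℝ) → ℝ} {a b l : ℝ}
    (hf : ∀ x, 0 < f x) (hg : ∀ x, 0 < g x) (hv : ∀ x, 0 < v x)
    (hvint : ∀ x, v x = ∫ y, f (x - y) * g y)
    (hint : ∀ x, Integrable fun y => f (x - y) * g y)
    (hfc : ∀ x w, 2 * log (f x) ≤ log (f (x + w)) + log (f (x - w)) + a * (w ⬝ᵥ w))
    (hgc : ∀ x w, 2 * log (g x) ≤ log (g (x + w)) + log (g (x - w)) + b * (w ⬝ᵥ w))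
    (x w : Fin n → ℝ) :
    2 * log (v x) ≤ log (v (x + w)) + log (v (x - w))
      + (l ^ 2 * a + (1 - l) ^ 2 * b) * (w ⬝ᵥ w) := by
  set q := w ⬝ᵥ w with hq
  set A := v (x + w) with hA
  set B := v (x - w) with hB
  set K := (l ^ 2 * a + (1 - l) ^ 2 * b) * q with hK
  have hApos : 0 < A := hv _
  have hBpos : 0 < B := hv _
  set d := (1 - l) • w with hd
  set F : (Fin n → ℝ) → ℝ := fun y => f (x + w - (y + d)) * g (y + d) with hF
  set G : (Fin n → ℝ) → ℝ := fun y => f (x - w - (y - d)) * g (y - d) with hG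
  have hFi : Integrable F := (hint (x + w)).comp_add_right d
  have hGi : Integrable G := (hint (x - w)).comp_sub_right d
  have hFe : ∫ y, F y = A := by
    rw [hA, hvint]
    exact integral_add_right_eq_self (fun y => f (x + w - y) * g y) d
  have hGe : ∫ y, G y = B := by
    rw [hB, hvint]
    exact integral_sub_right_eq_self (fun y => f (x - w - y) * g y) d
  set C := exp ((log A + log B + K) / 2) with hC
  have hpt : ∀ y, f (x - y) * g y ≤ C * ((F y / A + G y / B) / 2) := by
    intro y
    have e1 : x + w - (y + d) = (x - y) + l • w := by rw [hd, sub_smul, one_smul]; abel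
    have e2 : x - w - (y - d) = (x - y) - l • w := by rw [hd, sub_smul, one_smul]; abel
    have hFp : 0 < F y := mul_pos (hf _) (hg _)
    have hGp : 0 < G y := mul_pos (hf _) (hg _)
    have h1 := hfc (x - y) (l • w)
    have h2 := hgc y d
    have hlF : log (F y) = log (f (x - y + l • w)) + log (g (y + d)) := by
      rw [hF, ← e1]; exact log_mul (hf _).ne' (hg _).ne'
    have hlG : log (G y) = log (f (x - y - l • w)) + log (g (y - d)) := by
      rw [hG, ← e2]; exact log_mul (hf _).ne' (hg _).ne'
    rw [hd] at h2
    simp only [smul_dotProduct, dotProduct_smul, smul_eq_mul, ← hq] at h1 h2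
    rw [← hd] at h2
    have hlog : log (f (x - y) * g y) ≤
        (log A + log B + K) / 2 + ((log (F y / A) + log (G y / B)) / 2) := by
      rw [log_mul (hf _).ne' (hg _).ne', log_div hFp.ne' hApos.ne', log_div hGp.ne' hBpos.ne',
        hlF, hlG, hK]
      linarith
    have hexp : exp ((log (F y / A) + log (G y / B)) / 2) ≤ (F y / A + G y / B) / 2 := by
      have := convexOn_exp.2 (mem_univ (log (F y / A))) (mem_univ (log (G y / B)))
        (by norm_num : (0 : ℝ) ≤ 1 / 2) (by norm_num : (0 : ℝ) ≤ 1 / 2) (by norm_num)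
      simp only [smul_eq_mul, exp_log (div_pos hFp hApos), exp_log (div_pos hGp hBpos)] at this
      calc _ = exp (1 / 2 * log (F y / A) + 1 / 2 * log (G y / B)) := by congr 1; ring
        _ ≤ _ := this
        _ = _ := by ring
    calc f (x - y) * g y = exp (log (f (x - y) * g y)) := (exp_log (mul_pos (hf _) (hg _))).symm
      _ ≤ _ := exp_le_exp.2 hlog
      _ = C * exp ((log (F y / A) + log (G y / B)) / 2) := exp_add _ _
      _ ≤ _ := mul_le_mul_of_nonneg_left hexp (exp_pos _).le
  have hle : v x ≤ C := by
    rw [hvint]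
    have hi : Integrable fun y => C * ((F y / A + G y / B) / 2) :=
      (((hFi.div_const A).add (hGi.div_const B)).div_const 2).const_mul C
    refine (integral_mono (hint x) hi hpt).trans_eq ?_
    rw [integral_const_mul, integral_div, integral_add (hFi.div_const A) (hGi.div_const B),
      integral_div, integral_div, hFe, hGe, div_self hApos.ne', div_self hBpos.ne']
    norm_num
  have := log_le_log (hv x) hle
  rw [hC, log_exp] at this
  linarith

/-- The optimal splitting parameter for the convolution estimate. -/
lemma exists_split_le {a b t : ℝ} (ha : 0 ≤ a) (hb : 0 ≤ b) (ht : 0 < t) :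
    ∃ l : ℝ, l ^ 2 * (1 / (2 * a * t)) + (1 - l) ^ 2 * (1 / (2 * b * t))
      ≤ 1 / (2 * (a + b) * t) := by
  rcases ha.eq_or_lt with rfl | ha
  · exact ⟨1, by simp; positivity⟩
  rcases hb.eq_or_lt with rfl | hb
  · exact ⟨0, by simp; positivity⟩
  refine ⟨a / (a + b), le_of_eq ?_⟩
  field_simp
  ring

lemma contDiff_slice {n : ℕ} {u : ℝ → (Fin n → ℝ) → ℝ}
    (hu : ContDiffOn ℝ (⊤ : ℕ∞) (Function.uncurry u) (Set.Ioi (0 : ℝ) ×ˢ Set.univ))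
    {t : ℝ} (ht : 0 < t) : ContDiff ℝ 2 (u t) := by
  rw [← contDiffOn_univ]
  exact (hu.of_le (by norm_cast)).comp
    (contDiff_const.prodMk contDiff_id).contDiffOn (s := univ)
    (f := fun x : Fin n → ℝ => (t, x)) fun x _ => ⟨ht, mem_univ _⟩

/-- Closure of the matrix Li–Yau estimate under the convolution operation
`ũ^{1/p} = u₁^{1/p₁} * u₂^{1/p₂}`. -/
theorem convolution_LiYau_closure
    {n : ℕ} (hn : 1 ≤ n)
    (p p₁ p₂ σ σ₁ σ₂ : ℝ)
    (hp : 1 ≤ p) (hp₁ : 1 ≤ p₁) (hp₂ : 1 ≤ p₂)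
    (hscaling : 1 / p₁ + 1 / p₂ = 1 + 1 / p)
    (hσ : 0 ≤ σ) (hσ₁ : 0 ≤ σ₁) (hσ₂ : 0 ≤ σ₂)
    (hσ_eq : σ₁ * (p₂ * conjExp p₂) = σ₂ * (p₁ * conjExp p₁))
    (hσ_sum : σ * p = σ₁ * p₁ + σ₂ * p₂)
    (u₁ u₂ : ℝ → (Fin n → ℝ) → ℝ)
    (h₁_smooth : ContDiffOn ℝ (⊤ : ℕ∞) (Function.uncurry u₁) (Set.Ioi (0:ℝ) ×ˢ Set.univ))
    (h₂_smooth : ContDiffOn ℝ (⊤ : ℕ∞) (Function.uncurry u₂) (Set.Ioi (0:ℝ) ×ˢ Set.univ))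
    (h₁_pos : ∀ t > (0:ℝ), ∀ x, 0 < u₁ t x)
    (h₂_pos : ∀ t > (0:ℝ), ∀ x, 0 < u₂ t x)
    (v : ℝ → (Fin n → ℝ) → ℝ)
    (hv : v = fun t x => ∫ y, (u₁ t (x - y)) ^ (1 / p₁) * (u₂ t y) ^ (1 / p₂))
    (hconv_int : ∀ t > (0:ℝ), ∀ x,
      Integrable (fun y => (u₁ t (x - y)) ^ (1 / p₁) * (u₂ t y) ^ (1 / p₂)))
    (hv_pos : ∀ t > (0:ℝ), ∀ x, 0 < v t x)
    (hv_smooth : ContDiffOn ℝ (⊤ : ℕ∞) (Function.uncurry v) (Set.Ioi (0:ℝ) ×ˢ Set.univ))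
    (hD1 : ∀ t > (0:ℝ), ∀ x, ∀ i,
      pd (v t) i x
        = ∫ y, pd (fun z => (u₁ t z) ^ (1 / p₁)) i (x - y) * (u₂ t y) ^ (1 / p₂))
    (hD2a : ∀ t > (0:ℝ), ∀ x, ∀ i j,
      hess' (v t) x i j
        = ∫ y, pd (fun z => (u₁ t z) ^ (1 / p₁)) i (x - y)
            * pd (fun z => (u₂ t z) ^ (1 / p₂)) j y)
    (hD2b : ∀ t > (0:ℝ), ∀ x, ∀ i j,
      hess' (v t) x i j
        = ∫ y, pd (fun z => pd (fun w => (u₁ t w) ^ (1 / p₁)) j z) i (x - y)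
            * (u₂ t y) ^ (1 / p₂))
    (hD2c : ∀ t > (0:ℝ), ∀ x, ∀ i j,
      hess' (v t) x i j
        = ∫ y, (u₁ t (x - y)) ^ (1 / p₁)
            * pd (fun z => pd (fun w => (u₂ t w) ^ (1 / p₂)) j z) i y)
    (util : ℝ → (Fin n → ℝ) → ℝ)
    (hutil : util = fun t x => (v t x) ^ p)
    (h₁_LiYau : ∀ t > (0:ℝ), ∀ x,
      (hess' (fun y => Real.log (u₁ t y)) x
        + (1 / (2 * σ₁ * t)) • (1 : Matrix (Fin n) (Fin n) ℝ)).PosSemidef)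
    (h₂_LiYau : ∀ t > (0:ℝ), ∀ x,
      (hess' (fun y => Real.log (u₂ t y)) x
        + (1 / (2 * σ₂ * t)) • (1 : Matrix (Fin n) (Fin n) ℝ)).PosSemidef) :
    ∀ t > (0:ℝ), ∀ x,
      (hess' (fun y => Real.log (util t y)) x
        + (1 / (2 * σ * t)) • (1 : Matrix (Fin n) (Fin n) ℝ)).PosSemidef := by
  intro t ht x
  have hpp : 0 < p := by linarith
  have hpp₁ : 0 < p₁ := by linarith
  have hpp₂ : 0 < p₂ := by linarith
  have hlog : ∀ {u : ℝ → (Fin n → ℝ) → ℝ},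
      ContDiffOn ℝ (⊤ : ℕ∞) (Function.uncurry u) (Set.Ioi (0 : ℝ) ×ˢ Set.univ) →
      (∀ t > (0:ℝ), ∀ x, 0 < u t x) → ContDiff ℝ 2 fun y => Real.log (u t y) :=
    fun hu hpos => (contDiff_slice hu ht).log fun y => (hpos t ht y).ne'
  have hutil_log : (fun y => Real.log (util t y)) = fun y => p * Real.log (v t y) := by
    funext y
    rw [hutil]
    exact Real.log_rpow (hv_pos t ht y) p
  have hpow : ∀ {u : ℝ → (Fin n → ℝ) → ℝ} {r c : ℝ}, 0 < r →
      ContDiffOn ℝ (⊤ : ℕ∞) (Function.uncurry u) (Set.Ioi (0 : ℝ) ×ˢ Set.univ) →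
      (∀ t > (0:ℝ), ∀ x, 0 < u t x) →
      (∀ x, (hess' (fun y => Real.log (u t y)) x
        + (1 / (2 * c * t)) • (1 : Matrix (Fin n) (Fin n) ℝ)).PosSemidef) →
      ∀ x w, 2 * Real.log (u t x ^ (1 / r)) ≤ Real.log (u t (x + w) ^ (1 / r))
        + Real.log (u t (x - w) ^ (1 / r)) + (1 / (2 * (c * r) * t)) * (w ⬝ᵥ w) := by
    intro u r c hr hu hpos h x w
    have key := two_mul_le_of_posSemidef_hess' (hlog hu hpos) h x w
    simp only [Real.log_rpow (hpos t ht _)]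
    have hc : 1 / (2 * (c * r) * t) = 1 / r * (1 / (2 * c * t)) := by
      simp only [one_div, mul_inv]
      ring
    rw [hc]
    have := mul_le_mul_of_nonneg_left key (one_div_pos.2 hr).le
    linarith
  obtain ⟨l, hl⟩ := exists_split_le (mul_nonneg hσ₁ hpp₁.le) (mul_nonneg hσ₂ hpp₂.le) ht
  rw [← hσ_sum] at hl
  rw [hutil_log]
  refine posSemidef_hess'_of_two_mul_le (contDiff_const.mul (hlog hv_smooth hv_pos)) fun w => ?_
  have key := two_mul_log_integral_le (l := l)
    (fun y => Real.rpow_pos_of_pos (h₁_pos t ht y) (1 / p₁))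
    (fun y => Real.rpow_pos_of_pos (h₂_pos t ht y) (1 / p₂)) (hv_pos t ht)
    (fun x => by rw [hv]) (hconv_int t ht)
    (hpow hpp₁ h₁_smooth h₁_pos (h₁_LiYau t ht)) (hpow hpp₂ h₂_smooth h₂_pos (h₂_LiYau t ht)) x w
  have hq : 0 ≤ w ⬝ᵥ w := Finset.sum_nonneg fun i _ => mul_self_nonneg (w i)
  have hpc : 1 / (2 * σ * t) = p * (1 / (2 * (σ * p) * t)) := by
    simp only [one_div, mul_inv]
    field_simp
  have := mul_le_mul_of_nonneg_left
    (key.trans (add_le_add_right (mul_le_mul_of_nonneg_right hl hq) _)) hpp.le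
  rw [hpc]
  linarith
end
end
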